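/- Let m, p ∈ ℕ and let g : (0,∞) → ℝ lie in D^p ∩ K^{p+m}. Then there exists f : (0,∞) → ℝ such that Δ^{m+1} f = g on (0,∞), f(k) = 0 for k = 1,…,m+1, Δ^k f lies in K^{p+m} for every k = 0,…,m, and f lies in D^{p+m+1}. -/

import Mathlib

open Finset Filter

/-- Forward difference operator: `Δ f x = f (x + 1) - f x`. -/
noncomputable def fdiff (f : ℝ → ℝ) : ℝ → ℝ := fun x => f (x + 1) - f x

/-- Generalized binomial coefficient `C(x, j) = x (x-1) ⋯ (x-j+1) / j!`. -/
noncomputable def gbinom (x : ℝ) (j : ℕ) : ℝ :=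
  (∏ i ∈ Finset.range j, (x - i)) / (Nat.factorial j)

/-- Divided difference of `f` at the points `x 0, …, x (n-1)`. -/
noncomputable def divDiff (f : ℝ → ℝ) {n : ℕ} (x : Fin n → ℝ) : ℝ :=
  ∑ i, f (x i) / ∏ j ∈ Finset.univ.erase i, (x i - x j)

/-- `f` is `p`-convex on the set `S`: every divided difference of `f`
at `p + 2` pairwise distinct points of `S` is nonnegative. -/
def ConvexOrderOn (f : ℝ → ℝ) (p : ℕ) (S : Set ℝ) : Prop :=
  ∀ x : Fin (p + 2) → ℝ, (∀ i, x i ∈ S) → Function.Injective x → 0 ≤ divDiff f x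

/-- The class `K^p`: functions that are eventually `p`-convex or eventually `p`-concave. -/
def EvK (p : ℕ) (f : ℝ → ℝ) : Prop :=
  (∃ a > (0 : ℝ), ConvexOrderOn f p (Set.Ioi a)) ∨
    (∃ a > (0 : ℝ), ConvexOrderOn (fun x => -f x) p (Set.Ioi a))

/-- The class `D^p`: functions with `Δ^p f (n) → 0` as `n → ∞` along the integers. -/
def DD (p : ℕ) (f : ℝ → ℝ) : Prop :=
  Filter.Tendsto (fun n : ℕ => (fdiff^[p] f) n) Filter.atTop (nhds 0)

/-- The digamma function `ψ = Γ'/Γ`. -/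
noncomputable def digamma (x : ℝ) : ℝ := deriv Real.Gamma x / Real.Gamma x

/-- A multiple-gamma sequence: `G 0 = id`, `G (m+1) (x+1) = G m x * G (m+1) x`,
`G m 1 = 1`, each `G m` is positive and `C^∞` on `(0,∞)`, and the `m`-th derivative
of `ln ∘ G m` is increasing on `(0,∞)`. -/
def IsMultipleGammaSeq (G : ℕ → ℝ → ℝ) : Prop :=
  (∀ m, ∀ x > (0 : ℝ), 0 < G m x) ∧
  (∀ m, ContDiffOn ℝ (⊤ : ℕ∞) (G m) (Set.Ioi 0)) ∧
  (∀ x > (0 : ℝ), G 0 x = x) ∧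
  (∀ m, ∀ x > (0 : ℝ), G (m + 1) (x + 1) = G m x * G (m + 1) x) ∧
  (∀ m, G m 1 = 1) ∧
  (∀ m, StrictMonoOn
    (iteratedDerivWithin m (fun x => Real.log (G m x)) (Set.Ioi 0)) (Set.Ioi 0))

section DividedDifferences

lemma divDiff_add (f g : ℝ → ℝ) {n : ℕ} (x : Fin n → ℝ) :
    divDiff (fun t => f t + g t) x = divDiff f x + divDiff g x := by
  simp [divDiff, add_div, Finset.sum_add_distrib]

lemma divDiff_neg (f : ℝ → ℝ) {n : ℕ} (x : Fin n → ℝ) :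
    divDiff (fun t => -f t) x = -divDiff f x := by
  simp [divDiff, neg_div]

lemma divDiff_sum (F : ℕ → ℝ → ℝ) (N : ℕ) {n : ℕ} (x : Fin n → ℝ) :
    divDiff (fun t => ∑ k ∈ range N, F k t) x = ∑ k ∈ range N, divDiff (F k) x := by
  simp only [divDiff, Finset.sum_div]
  exact Finset.sum_comm

lemma divDiff_comp_add_left (f : ℝ → ℝ) (s : ℝ) {n : ℕ} (x : Fin n → ℝ) :
    divDiff (fun t => f (s + t)) x = divDiff f (fun i => s + x i) := by
  simp [divDiff]

lemma tendsto_divDiff {F : ℕ → ℝ → ℝ} {f : ℝ → ℝ}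
    (h : ∀ t, Tendsto (fun n => F n t) atTop (nhds (f t))) {n : ℕ} (x : Fin n → ℝ) :
    Tendsto (fun k => divDiff (F k) x) atTop (nhds (divDiff f x)) :=
  tendsto_finsetSum _ fun i _ => (h (x i)).div_const _

/-- Divided differences at `q + 2` points annihilate polynomials of degree at most `q`. -/
lemma divDiff_polynomial_eval (P : Polynomial ℝ) {q : ℕ} (hP : P.natDegree ≤ q)
    {x : Fin (q + 2) → ℝ} (hx : Function.Injective x) :
    divDiff (fun t => P.eval t) x = 0 := by
  have hdeg : P.degree < #(Finset.univ : Finset (Fin (q + 2))) := by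
    rw [Finset.card_univ, Fintype.card_fin]
    exact lt_of_le_of_lt Polynomial.degree_le_natDegree (by exact_mod_cast (by omega))
  have h := Lagrange.coeff_eq_sum (s := Finset.univ) (v := x) hx.injOn hdeg
  rw [divDiff, ← h]
  exact Polynomial.coeff_eq_zero_of_natDegree_lt (by simp; omega)

lemma divDiff_const (c : ℝ) {q : ℕ} {x : Fin (q + 2) → ℝ} (hx : Function.Injective x) :
    divDiff (fun _ => c) x = 0 := by
  simpa using divDiff_polynomial_eval (Polynomial.C c) (q := q) (by simp) hx

/-- A divided difference of a function vanishing at all nodes but the last two. -/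
lemma divDiff_snoc_snoc (h : ℝ → ℝ) {q : ℕ} (v : Fin q → ℝ) (hv : ∀ i, h (v i) = 0)
    (y z : ℝ) :
    divDiff h (Fin.snoc (Fin.snoc v y : Fin (q + 1) → ℝ) z : Fin (q + 2) → ℝ) =
      h y / ((∏ i, (y - v i)) * (y - z)) + h z / ((∏ i, (z - v i)) * (z - y)) := by
  have herase : ∀ (n : ℕ) (i : Fin n) (F : Fin n → ℝ),
      ∏ j ∈ Finset.univ.erase i, F j = ∏ j, if j = i then 1 else F j := by
    intro n i F
    rw [← Finset.prod_erase (a := i) Finset.univ (by simp)]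
    refine Finset.prod_congr rfl fun j hj => ?_
    rw [if_neg (Finset.ne_of_mem_erase hj)]
  simp only [divDiff, herase]
  simp [Fin.sum_univ_castSucc, Fin.prod_univ_castSucc, hv, Fin.ext_iff, Fin.snoc_castSucc,
    Fin.snoc_last, Fin.is_lt, ne_of_lt, ne_of_gt]

end DividedDifferences

section GeneralizedBinomial

lemma gbinom_zero_right (x : ℝ) : gbinom x 0 = 1 := by simp [gbinom]

lemma gbinom_zero_succ (j : ℕ) : gbinom 0 (j + 1) = 0 := by
  simp [gbinom, Finset.prod_range_succ']

lemma succ_mul_gbinom_succ (x : ℝ) (j : ℕ) :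
    (j + 1) * gbinom x (j + 1) = (x - j) * gbinom x j := by
  have := Nat.factorial_ne_zero j
  rw [gbinom, gbinom, Finset.prod_range_succ, Nat.factorial_succ]
  push_cast
  field_simp

lemma gbinom_add_one_succ (x : ℝ) (j : ℕ) :
    gbinom (x + 1) (j + 1) = gbinom x (j + 1) + gbinom x j := by
  induction j with
  | zero => simp [gbinom]
  | succ j ih =>
    have h1 := succ_mul_gbinom_succ (x + 1) (j + 1)
    have h2 := succ_mul_gbinom_succ x (j + 1)
    have h3 := succ_mul_gbinom_succ x j
    have hj : (j : ℝ) + 2 ≠ 0 := by positivity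
    apply mul_left_cancel₀ hj
    rw [ih] at h1
    push_cast at h1 h2
    linear_combination h1 - h2 - h3

lemma gbinom_natCast_of_lt {k j : ℕ} (h : k < j) : gbinom k j = 0 := by
  rw [gbinom, Finset.prod_eq_zero (Finset.mem_range.2 h) (sub_self _), zero_div]

lemma gbinom_self (j : ℕ) : gbinom j j = 1 := by
  induction j with
  | zero => exact gbinom_zero_right _
  | succ j ih =>
    rw [Nat.cast_succ, gbinom_add_one_succ, ih, gbinom_natCast_of_lt (Nat.lt_succ_self j), zero_add]

lemma gbinom_neg_one (j : ℕ) : gbinom (-1) j = (-1) ^ j := by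
  induction j with
  | zero => simp [gbinom]
  | succ j ih =>
    have := gbinom_add_one_succ (-1) j
    rw [neg_add_cancel, gbinom_zero_succ, ih] at this
    rw [pow_succ]
    linarith

lemma gbinom_ne_zero_of_neg {x : ℝ} (hx : x < 0) (j : ℕ) : gbinom x j ≠ 0 := by
  refine div_ne_zero (Finset.prod_ne_zero_iff.2 fun i _ => ?_) (by exact_mod_cast j.factorial_ne_zero)
  have : (0 : ℝ) ≤ i := Nat.cast_nonneg i
  linarith

lemma prod_sub_eq_factorial_mul_gbinom (x : ℝ) (q : ℕ) :
    ∏ i : Fin q, (x - (i : ℕ)) = q.factorial * gbinom x q := by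
  have := Nat.factorial_ne_zero q
  rw [Fin.prod_univ_eq_prod_range (fun i : ℕ => x - (i : ℝ)) q, gbinom]
  field_simp

lemma exists_polynomial_gbinom (j : ℕ) :
    ∃ P : Polynomial ℝ, P.natDegree ≤ j ∧ ∀ x, P.eval x = gbinom x j := by
  refine ⟨Polynomial.C (j.factorial : ℝ)⁻¹ * ∏ i ∈ range j, (Polynomial.X - Polynomial.C (i : ℝ)),
    ?_, fun x => ?_⟩
  · refine (Polynomial.natDegree_C_mul_le _ _).trans ?_
    rw [Polynomial.natDegree_finsetProd_X_sub_C_eq_card]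
    simp
  · rw [gbinom, Polynomial.eval_mul, Polynomial.eval_prod]
    simp [div_eq_inv_mul]

/-- A combination of generalized binomial coefficients of index at most `q` is annihilated by
divided differences of order `q + 1`. -/
lemma divDiff_sum_gbinom {q N : ℕ} (c : ℕ → ℝ) (e : ℕ → ℕ) (he : ∀ j < N, e j ≤ q)
    {x : Fin (q + 2) → ℝ} (hx : Function.Injective x) :
    divDiff (fun t => ∑ j ∈ range N, gbinom t (e j) * c j) x = 0 := by
  choose P hPdeg hPeval using exists_polynomial_gbinom
  have h := divDiff_polynomial_eval (∑ j ∈ range N, P (e j) * Polynomial.C (c j)) (q := q)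
    (Polynomial.natDegree_sum_le_of_forall_le _ _ fun j hj =>
      (Polynomial.natDegree_mul_C_le _ _).trans ((hPdeg _).trans (he j (Finset.mem_range.1 hj)))) hx
  simpa [Polynomial.eval_finsetSum, hPeval] using h

end GeneralizedBinomial

section NewtonRemainder

/-- Remainder at `s + x` of the Newton interpolation of `g` at `s, s + 1, …, s + q - 1`. -/
noncomputable def newtonRem (g : ℝ → ℝ) (q : ℕ) (s x : ℝ) : ℝ :=
  g (s + x) - ∑ j ∈ range q, gbinom x j * fdiff^[j] g s

lemma fdiff_iterate_add_one (g : ℝ → ℝ) (j : ℕ) (s : ℝ) :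
    fdiff^[j] g (s + 1) = fdiff^[j] g s + fdiff^[j + 1] g s := by
  rw [Function.iterate_succ_apply', fdiff]
  ring

lemma newtonRem_succ (g : ℝ → ℝ) (q : ℕ) (s x : ℝ) :
    newtonRem g (q + 1) s x = newtonRem g q s x - gbinom x q * fdiff^[q] g s := by
  rw [newtonRem, newtonRem, Finset.sum_range_succ]
  ring

lemma newtonRem_succ_add_one (g : ℝ → ℝ) (q : ℕ) (s x : ℝ) :
    newtonRem g (q + 1) s (x + 1) =
      newtonRem g (q + 1) (s + 1) x + gbinom x q * fdiff^[q + 1] g s := by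
  induction q with
  | zero =>
    simp [newtonRem, gbinom_zero_right, fdiff]
    ring_nf
  | succ q ih =>
    rw [newtonRem_succ, ih, newtonRem_succ g (q + 1), gbinom_add_one_succ,
      fdiff_iterate_add_one g (q + 1)]
    ring

lemma newtonRem_zero_right (g : ℝ → ℝ) (q : ℕ) (s : ℝ) : newtonRem g (q + 1) s 0 = 0 := by
  simp [newtonRem, Finset.sum_range_succ', gbinom_zero_succ, gbinom_zero_right]

lemma newtonRem_natCast (g : ℝ → ℝ) {q k : ℕ} (h : k < q) (s : ℝ) : newtonRem g q s k = 0 := by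
  obtain ⟨q, rfl⟩ : ∃ r, q = r + 1 := ⟨q - 1, by omega⟩
  induction k generalizing s with
  | zero => exact_mod_cast newtonRem_zero_right g q s
  | succ k ih =>
    rw [Nat.cast_succ, newtonRem_succ_add_one, ih _ (by omega), gbinom_natCast_of_lt (by omega)]
    ring

lemma newtonRem_self (g : ℝ → ℝ) (q : ℕ) (s : ℝ) : newtonRem g q s q = fdiff^[q] g s := by
  have h := newtonRem_succ g q s q
  rw [newtonRem_natCast g (Nat.lt_succ_self q), gbinom_self] at h
  linarith

lemma newtonRem_neg_one (g : ℝ → ℝ) (q : ℕ) (s : ℝ) :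
    newtonRem g q s (-1) = gbinom (-1) q * fdiff^[q] g (s - 1) := by
  cases q with
  | zero => simp [newtonRem, gbinom_zero_right, sub_eq_add_neg]
  | succ q =>
    have h := newtonRem_succ_add_one g q (s - 1) (-1)
    rw [neg_add_cancel, newtonRem_zero_right, sub_add_cancel] at h
    rw [gbinom_neg_one] at h ⊢
    rw [pow_succ]
    linarith

/-- For a `q`-convex function the normalized Newton remainder is monotone. -/
lemma newtonRem_div_gbinom_le {g : ℝ → ℝ} {q : ℕ} {a s y z : ℝ}
    (hg : ConvexOrderOn g q (Set.Ioi a)) (hs : a < s) (hy : a < s + y) (hz : a < s + z)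
    (hy0 : gbinom y q ≠ 0) (hz0 : gbinom z q ≠ 0) (hyz : y < z) :
    newtonRem g q s y / gbinom y q ≤ newtonRem g q s z / gbinom z q := by
  set v : Fin q → ℝ := fun i => (i : ℕ) with hv
  set w : Fin (q + 2) → ℝ := Fin.snoc (Fin.snoc v y : Fin (q + 1) → ℝ) z with hw
  have hne : ∀ t, gbinom t q ≠ 0 → ∀ i, v i ≠ t := by
    rintro _ ht i rfl
    exact ht (gbinom_natCast_of_lt i.2)
  have hwinj : Function.Injective w := by
    refine Fin.snoc_injective_iff.2 ⟨Fin.snoc_injective_iff.2 ⟨?_, ?_⟩, ?_⟩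
    · intro i j hij
      exact Fin.ext (Nat.cast_injective hij)
    · rintro ⟨i, hi⟩
      exact hne y hy0 i hi
    · rintro ⟨i, hi⟩
      induction i using Fin.lastCases with
      | last => rw [Fin.snoc_last] at hi; exact hyz.ne hi
      | cast i => rw [Fin.snoc_castSucc] at hi; exact hne z hz0 i hi
  have hmem : ∀ i, s + w i ∈ Set.Ioi a := by
    intro i
    induction i using Fin.lastCases with
    | last => simpa [hw] using hz
    | cast i =>
      induction i using Fin.lastCases with
      | last => simpa [hw] using hy
      | cast i =>
        have : (0 : ℝ) ≤ (i : ℕ) := Nat.cast_nonneg _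
        simp only [hw, hv, Fin.snoc_castSucc, Set.mem_Ioi]
        linarith
  have hpos := hg (fun i => s + w i) hmem fun i j hij => hwinj (add_left_cancel hij)
  rw [← divDiff_comp_add_left] at hpos
  have hsplit : (fun t => g (s + t)) = fun t => newtonRem g q s t +
      ∑ j ∈ range q, gbinom t j * fdiff^[j] g s := by
    funext t
    rw [newtonRem]
    ring
  rw [hsplit, divDiff_add, divDiff_sum_gbinom _ (fun j => j) (fun j hj => hj.le) hwinj, add_zero,
    hw, divDiff_snoc_snoc _ _ (fun i => newtonRem_natCast g i.2 s),
    prod_sub_eq_factorial_mul_gbinom, prod_sub_eq_factorial_mul_gbinom] at hpos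
  have hfac : (0 : ℝ) < q.factorial := by exact_mod_cast Nat.factorial_pos q
  have hzy : 0 < z - y := sub_pos.2 hyz
  have key : newtonRem g q s y / (q.factorial * gbinom y q * (y - z)) +
      newtonRem g q s z / (q.factorial * gbinom z q * (z - y)) =
      (newtonRem g q s z / gbinom z q - newtonRem g q s y / gbinom y q) /
        (q.factorial * (z - y)) := by
    rw [show y - z = -(z - y) by ring]
    field_simp
    ring
  rw [key] at hpos
  have := (le_div_iff₀ (mul_pos hfac hzy)).1 hpos
  linarith

end NewtonRemainder

section Convergence

lemma exists_tendsto_of_abs_sub_le {u v : ℕ → ℝ} {l : ℝ} (hv : Tendsto v atTop (nhds l))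
    (huv : ∀ᶠ n in atTop, |u (n + 1) - u n| ≤ v (n + 1) - v n) :
    ∃ L, Tendsto u atTop (nhds L) := by
  obtain ⟨N, hN⟩ := eventually_atTop.1 huv
  have hb : ∀ n, |u (n + 1 + N) - u (n + N)| ≤ v (n + 1 + N) - v (n + N) := fun n => by
    simpa [add_right_comm] using hN (n + N) (Nat.le_add_left _ _)
  have hpos : ∀ n, 0 ≤ v (n + 1 + N) - v (n + N) := fun n => (abs_nonneg _).trans (hb n)
  have hmono : Monotone fun n => v (n + N) := monotone_nat_of_le_succ fun n => sub_nonneg.1 (hpos n)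
  have hlim : Tendsto (fun n => v (n + N)) atTop (nhds l) := (tendsto_add_atTop_iff_nat N).2 hv
  have hsum : Summable fun n => v (n + 1 + N) - v (n + N) := by
    refine summable_of_sum_range_le (c := l - v (0 + N)) hpos fun n => ?_
    rw [Finset.sum_range_sub fun n => v (n + N)]
    exact sub_le_sub_right (hmono.ge_of_tendsto hlim n) _
  obtain ⟨S, hS⟩ : Summable fun n => u (n + 1 + N) - u (n + N) := hsum.of_norm_bounded hb
  have hS' := hS.tendsto_sum_nat
  simp only [Finset.sum_range_sub fun n => u (n + N)] at hS'
  refine ⟨S + u (0 + N), (tendsto_add_atTop_iff_nat N).1 ?_⟩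
  simpa using hS'.add_const (u (0 + N))

lemma forall_of_iff_add_one {P : ℝ → Prop} (hP : ∀ x, P (x + 1) ↔ P x)
    (h : ∀ x ∈ Set.Ico (-1 : ℝ) 0, P x) (x : ℝ) : P x := by
  have hper : Function.Periodic P 1 := fun x => propext (hP x)
  obtain ⟨y, hy, hxy⟩ := hper.exists_mem_Ico one_pos x (-1)
  rw [hxy]
  exact h y (by simpa using hy)

lemma newtonRem_div_gbinom_mem_Icc {g : ℝ → ℝ} {q : ℕ} {a s x : ℝ}
    (hg : ConvexOrderOn g q (Set.Ioi a)) (hs : a < s - 1) (hx : x ∈ Set.Ico (-1 : ℝ) 0) :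
    newtonRem g q s x / gbinom x q ∈ Set.Icc (fdiff^[q] g (s - 1)) (fdiff^[q] g s) := by
  have hq : (0 : ℝ) ≤ q := Nat.cast_nonneg q
  have hx0 := gbinom_ne_zero_of_neg hx.2 q
  have h1 := gbinom_ne_zero_of_neg neg_one_lt_zero q
  have hneg : newtonRem g q s (-1) / gbinom (-1) q = fdiff^[q] g (s - 1) := by
    rw [newtonRem_neg_one, mul_div_cancel_left₀ _ h1]
  constructor
  · rw [← hneg]
    rcases hx.1.eq_or_lt with rfl | hlt
    · exact le_rfl
    · exact newtonRem_div_gbinom_le hg (by linarith) (by linarith) (by linarith) h1 hx0 hlt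
  · have h := newtonRem_div_gbinom_le (s := s) hg (by linarith) (by linarith [hx.1]) (by linarith) hx0
      (by rw [gbinom_self]; exact one_ne_zero) (show x < q by linarith [hx.2])
    rwa [newtonRem_self, gbinom_self, div_one] at h

lemma tendsto_fdiff_iterate_sub_one {g : ℝ → ℝ} {q : ℕ} (hD : DD q g) :
    Tendsto (fun n : ℕ => fdiff^[q] g (n - 1)) atTop (nhds 0) := by
  rw [← tendsto_add_atTop_iff_nat 1]
  simpa [DD] using hD

lemma eventually_newtonRem_mem_Icc {g : ℝ → ℝ} {q : ℕ} {a x : ℝ}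
    (hg : ConvexOrderOn g q (Set.Ioi a)) (hx : x ∈ Set.Ico (-1 : ℝ) 0) :
    ∀ᶠ n : ℕ in atTop, newtonRem g q n x / gbinom x q ∈
      Set.Icc (fdiff^[q] g (n - 1)) (fdiff^[q] g n) := by
  filter_upwards [tendsto_natCast_atTop_atTop.eventually_gt_atTop (a + 1)] with n hn
  exact newtonRem_div_gbinom_mem_Icc hg (by linarith) hx

lemma exists_newtonRem_add_one (g : ℝ → ℝ) (q : ℕ) (x : ℝ) :
    ∃ c, ∀ s, newtonRem g q s (x + 1) = newtonRem g q (s + 1) x + c * fdiff^[q] g s := by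
  cases q with
  | zero => exact ⟨0, fun s => by simp [newtonRem, add_left_comm, add_comm]⟩
  | succ q => exact ⟨gbinom x q, fun s => newtonRem_succ_add_one g q s x⟩

lemma tendsto_newtonRem {g : ℝ → ℝ} {q : ℕ} {a : ℝ}
    (hg : ConvexOrderOn g q (Set.Ioi a)) (hD : DD q g) (x : ℝ) :
    Tendsto (fun n : ℕ => newtonRem g q n x) atTop (nhds 0) := by
  refine forall_of_iff_add_one
    (P := fun x => Tendsto (fun n : ℕ => newtonRem g q n x) atTop (nhds 0)) (fun x => ?_)
    (fun x hx => ?_) x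
  · obtain ⟨c, hc⟩ := exists_newtonRem_add_one g q x
    have hcD : Tendsto (fun n : ℕ => c * fdiff^[q] g n) atTop (nhds 0) := by
      simpa using Tendsto.const_mul c hD
    rw [← tendsto_add_atTop_iff_nat (f := fun n : ℕ => newtonRem g q n x) 1]
    simp only [hc, Nat.cast_add, Nat.cast_one]
    refine ⟨fun h => ?_, fun h => ?_⟩
    · simpa using h.sub hcD
    · simpa using h.add hcD
  · have hev := eventually_newtonRem_mem_Icc hg hx
    have h := tendsto_of_tendsto_of_tendsto_of_le_of_le' (tendsto_fdiff_iterate_sub_one hD) hD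
      (hev.mono fun n hn => hn.1) (hev.mono fun n hn => hn.2)
    simpa [div_mul_cancel₀ _ (gbinom_ne_zero_of_neg hx.2 q)] using h.mul_const (gbinom x q)

/-- Approximations of the principal indefinite sum of `g`. -/
noncomputable def indefSumApprox (g : ℝ → ℝ) (q n : ℕ) (x : ℝ) : ℝ :=
  ∑ j ∈ range q, gbinom x (j + 1) * fdiff^[j] g n - ∑ k ∈ range n, (g (k + x) - g k)

lemma indefSumApprox_succ (g : ℝ → ℝ) (q n : ℕ) (x : ℝ) :
    indefSumApprox g q (n + 1) x - indefSumApprox g q n x = -newtonRem g (q + 1) n x := by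
  simp only [indefSumApprox, newtonRem, Nat.cast_succ, fdiff_iterate_add_one, mul_add,
    Finset.sum_add_distrib, Finset.sum_range_succ (fun k : ℕ => g (k + x) - g k) n,
    Finset.sum_range_succ' (fun j => gbinom x j * fdiff^[j] g n), gbinom_zero_right,
    Function.iterate_zero, id]
  ring

lemma indefSumApprox_add_one (g : ℝ → ℝ) (q n : ℕ) (x : ℝ) :
    indefSumApprox g q n (x + 1) = indefSumApprox g q n x + (g x - newtonRem g q n x) := by
  have htel : ∑ k ∈ range n, (g (k + (x + 1)) - g k) =
      ∑ k ∈ range n, (g (k + x) - g k) + (g (n + x) - g x) := by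
    have h := Finset.sum_range_sub (fun k : ℕ => g (k + x)) n
    simp only [Nat.cast_add, Nat.cast_one, Nat.cast_zero, zero_add] at h
    rw [← h, ← Finset.sum_add_distrib]
    refine Finset.sum_congr rfl fun k _ => ?_
    rw [show (k : ℝ) + (x + 1) = k + 1 + x by ring]
    ring
  simp only [indefSumApprox, newtonRem, htel, gbinom_add_one_succ, add_mul, Finset.sum_add_distrib]
  ring

lemma exists_tendsto_indefSumApprox {g : ℝ → ℝ} {q : ℕ} {a : ℝ}
    (hg : ConvexOrderOn g q (Set.Ioi a)) (hD : DD q g) (x : ℝ) :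
    ∃ L, Tendsto (fun n => indefSumApprox g q n x) atTop (nhds L) := by
  refine forall_of_iff_add_one
    (P := fun x => ∃ L, Tendsto (fun n => indefSumApprox g q n x) atTop (nhds L)) (fun x => ?_)
    (fun x hx => ?_) x
  · have hR := (tendsto_newtonRem hg hD x).const_sub (g x)
    simp only [indefSumApprox_add_one]
    refine ⟨fun ⟨L, hL⟩ => ⟨L - (g x - 0), ?_⟩, fun ⟨L, hL⟩ => ⟨L + (g x - 0), hL.add hR⟩⟩
    simpa using hL.sub hR
  · refine exists_tendsto_of_abs_sub_le
      ((tendsto_fdiff_iterate_sub_one hD).const_mul |gbinom x q|) ?_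
    filter_upwards [eventually_newtonRem_mem_Icc hg hx] with n hn
    have hx0 := gbinom_ne_zero_of_neg hx.2 q
    have hrem : newtonRem g (q + 1) n x =
        gbinom x q * (newtonRem g q n x / gbinom x q - fdiff^[q] g n) := by
      rw [newtonRem_succ]
      field_simp
    rw [indefSumApprox_succ, abs_neg, hrem, abs_mul, ← mul_sub, Nat.cast_succ, add_sub_cancel_right]
    refine mul_le_mul_of_nonneg_left ?_ (abs_nonneg _)
    rw [abs_of_nonpos (by linarith [hn.2])]
    linarith [hn.1]

lemma divDiff_indefSumApprox (g : ℝ → ℝ) {q : ℕ} (n : ℕ) {x : Fin (q + 2) → ℝ}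
    (hx : Function.Injective x) :
    divDiff (indefSumApprox g q n) x = -∑ k ∈ range n, divDiff g (fun i => k + x i) := by
  have hsplit : indefSumApprox g q n = fun t =>
      (∑ j ∈ range q, gbinom t (j + 1) * fdiff^[j] g n + -∑ k ∈ range n, g (k + t)) +
        ∑ k ∈ range n, g k := by
    funext t
    rw [indefSumApprox, Finset.sum_sub_distrib]
    ring
  rw [hsplit, divDiff_add, divDiff_add, divDiff_sum_gbinom _ (fun j => j + 1) (fun j hj => hj) hx,
    divDiff_const _ hx, divDiff_neg, divDiff_sum (fun k t => g (k + t))]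
  simp only [divDiff_comp_add_left, zero_add, add_zero]

end Convergence

section IndefiniteSum

lemma exists_indefSum_of_convexOrderOn {g : ℝ → ℝ} {q : ℕ} {a : ℝ}
    (hg : ConvexOrderOn g q (Set.Ioi a)) (hD : DD q g) :
    ∃ f : ℝ → ℝ, fdiff f = g ∧ f 1 = 0 ∧ ConvexOrderOn (fun x => -f x) q (Set.Ioi a) := by
  choose F hF using exists_tendsto_indefSumApprox hg hD
  refine ⟨fun x => F x + -F 1, ?_, add_neg_cancel _, fun x hxa hx => ?_⟩
  · funext x
    have h := (hF x).add ((tendsto_newtonRem hg hD x).const_sub (g x))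
    simp only [← indefSumApprox_add_one] at h
    have := tendsto_nhds_unique h (hF (x + 1))
    simp only [fdiff]
    linarith
  · rw [divDiff_neg, divDiff_add, divDiff_const _ hx, add_zero, neg_nonneg]
    refine le_of_tendsto (tendsto_divDiff hF x) (Eventually.of_forall fun n => ?_)
    rw [divDiff_indefSumApprox g n hx, neg_nonpos]
    refine Finset.sum_nonneg fun k _ => hg _ (fun i => ?_) fun i j hij => hx (add_left_cancel hij)
    have h1 : a < x i := hxa i
    have h2 : (0 : ℝ) ≤ k := Nat.cast_nonneg k
    rw [Set.mem_Ioi]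
    linarith

lemma fdiff_neg (f : ℝ → ℝ) : fdiff (fun x => -f x) = fun x => -fdiff f x := by
  funext x
  simp only [fdiff]
  ring

lemma fdiff_iterate_neg (f : ℝ → ℝ) (q : ℕ) :
    fdiff^[q] (fun x => -f x) = fun x => -fdiff^[q] f x := by
  induction q with
  | zero => rfl
  | succ q ih => rw [Function.iterate_succ_apply', Function.iterate_succ_apply', ih, fdiff_neg]

lemma DD.neg {g : ℝ → ℝ} {q : ℕ} (h : DD q g) : DD q (fun x => -g x) := by
  rw [DD, fdiff_iterate_neg]
  simpa using Tendsto.neg h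

lemma DD.mono {g : ℝ → ℝ} {p q : ℕ} (h : DD p g) (hpq : p ≤ q) : DD q g := by
  induction q, hpq using Nat.le_induction with
  | base => exact h
  | succ q _ ih =>
    have h1 := (tendsto_add_atTop_iff_nat 1).2 ih
    simp only [Nat.cast_add, Nat.cast_one, fdiff_iterate_add_one] at h1
    simpa [DD] using h1.sub ih

lemma exists_indefSum {g : ℝ → ℝ} {q : ℕ} (hK : EvK q g) (hD : DD q g) :
    ∃ f : ℝ → ℝ, fdiff f = g ∧ f 1 = 0 ∧ EvK q f := by
  rcases hK with ⟨a, ha, hg⟩ | ⟨a, ha, hg⟩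
  · obtain ⟨f, hf, hf1, hconv⟩ := exists_indefSum_of_convexOrderOn hg hD
    exact ⟨f, hf, hf1, Or.inr ⟨a, ha, hconv⟩⟩
  · obtain ⟨f, hf, hf1, hconv⟩ := exists_indefSum_of_convexOrderOn hg hD.neg
    refine ⟨fun x => -f x, ?_, by simp [hf1], Or.inl ⟨a, ha, hconv⟩⟩
    rw [fdiff_neg, hf]
    simp

lemma exists_iterated_indefSum {q p : ℕ} {g : ℝ → ℝ} (hK : EvK q g) (hD : DD p g) (m : ℕ)
    (hq : p + m ≤ q) :
    ∃ f : ℝ → ℝ, fdiff^[m + 1] f = g ∧ ∀ k ≤ m, fdiff^[k] f 1 = 0 ∧ EvK q (fdiff^[k] f) := by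
  induction m with
  | zero =>
    obtain ⟨f, hf, hf1, hfK⟩ := exists_indefSum hK (hD.mono hq)
    refine ⟨f, hf, fun k hk => ?_⟩
    obtain rfl : k = 0 := by omega
    exact ⟨hf1, hfK⟩
  | succ m ih =>
    obtain ⟨h, hh, hhk⟩ := ih (by omega)
    have hhD : DD (p + (m + 1)) h := by rwa [DD, Function.iterate_add_apply, hh]
    have hhK : EvK q h := (hhk 0 (Nat.zero_le _)).2
    obtain ⟨f, hf, hf1, hfK⟩ := exists_indefSum hhK (hhD.mono hq)
    refine ⟨f, by rw [Function.iterate_succ_apply, hf, hh], fun k hk => ?_⟩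
    cases k with
    | zero => exact ⟨hf1, hfK⟩
    | succ k =>
      rw [Function.iterate_succ_apply, hf]
      exact hhk k (by omega)

lemma eq_zero_of_fdiff_iterate_eq_zero {f : ℝ → ℝ} {x : ℝ} {i : ℕ}
    (h : ∀ k ≤ i, fdiff^[k] f x = 0) : f (x + i) = 0 := by
  induction i generalizing f with
  | zero => simpa using h 0 le_rfl
  | succ i ih =>
    have h1 := ih fun k hk => h k (by omega)
    have h2 := ih (f := fdiff f) fun k hk => h (k + 1) (by omega)
    rw [fdiff, h1, sub_zero] at h2
    rw [Nat.cast_succ, ← add_assoc, h2]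

end IndefiniteSum

/-- Existence of the `(m+1)`-fold principal indefinite sum of `g ∈ D^p ∩ K^{p+m}`. -/
theorem stmt_3 (m p : ℕ) (g : ℝ → ℝ) (hgD : DD p g) (hgK : EvK (p + m) g) :
    ∃ f : ℝ → ℝ, (∀ x > (0 : ℝ), fdiff^[m + 1] f x = g x) ∧
      (∀ k ∈ Finset.Icc 1 (m + 1), f k = 0) ∧
      (∀ k ≤ m, EvK (p + m) (fdiff^[k] f)) ∧
      DD (p + m + 1) f := by
  obtain ⟨f, hf, hfk⟩ := exists_iterated_indefSum hgK hgD m le_rfl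
  refine ⟨f, fun x _ => by rw [hf], fun k hk => ?_, fun k hk => (hfk k hk).2, ?_⟩
  · obtain ⟨hk1, hk2⟩ := Finset.mem_Icc.1 hk
    have h := eq_zero_of_fdiff_iterate_eq_zero (i := k - 1) fun j hj => (hfk j (by omega)).1
    rwa [Nat.cast_sub hk1, Nat.cast_one, add_sub_cancel] at h
  · rwa [add_assoc, DD, Function.iterate_add_apply, hf]
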